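/- arXiv:1509.02997 — 4 statements merged into one kernel-verified Lean document; each statement's English description precedes it below -/
import Mathlib

section
/- A semiring S is a left CP-semiring if and only if there exist a ring R and a semiring T with S isomorphic as a semiring to R × T, such that R is a semisimple ring (IsSemisimpleRing R), T is zeroic (for every t ∈ T there exists m ∈ T with t + m = m), T is additively π-regular (there exist n ≥ 1 and y ∈ T with n • (1:T) = n • 1 + y + n • 1), and T is a left CP-semiring. -/
universe u

/-- A left CP-semiring: every cyclic left `S`-semimodule is projective. -/
def IsLeftCPSemiring (S : Type u) [Semiring S] : Prop :=
  ∀ (M : Type u) [AddCommMonoid M] [Module S M],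
    (∃ m : M, Submodule.span S {m} = ⊤) → Module.Projective S M

/-- Congruence form of the CP property. -/
def LCProp (S : Type u) [Semiring S] : Prop :=
  ∀ r : ModuleCon S S, ∃ e : S, r.r e 1 ∧ ∀ a b, r.r a b → a * e = b * e

theorem LCProp.of_cp {S : Type u} [Semiring S] (h : IsLeftCPSemiring S) : LCProp S := by
  intro r
  let q : S →ₗ[S] r.Quotient :=
    { toFun := fun s => (Quotient.mk r.toSetoid s : r.Quotient)
      map_add' := fun _ _ => rfl
      map_smul' := fun _ _ => rfl }
  have hq : Function.Surjective q := fun x => Quotient.exists_rep x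
  have hP : Module.Projective S r.Quotient := by
    apply h
    refine ⟨q 1, ?_⟩
    rw [eq_top_iff]
    intro x _
    obtain ⟨s, rfl⟩ := hq x
    rw [Submodule.mem_span_singleton]
    exact ⟨s, by rw [← map_smul]; simp⟩
  obtain ⟨g, hg⟩ := Module.projective_lifting_property q LinearMap.id hq
  have key : ∀ a, g (q a) = a * g (q 1) := by
    intro a
    rw [← smul_eq_mul, ← map_smul, ← map_smul]; simp
  refine ⟨g (q 1), ?_, ?_⟩
  · have : q (g (q 1)) = q 1 := LinearMap.congr_fun hg (q 1)
    exact Quotient.exact this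
  · intro a b hab
    have : q a = q b := Quotient.sound hab
    rw [← key, ← key, this]

theorem LCProp.cp {S : Type u} [Semiring S] (h : LCProp S) : IsLeftCPSemiring S := by
  intro M _ _ ⟨m, hm⟩
  let r : ModuleCon S S :=
    { r := fun a b => a • m = b • m
      iseqv := ⟨fun _ => rfl, fun h => h.symm, fun h h' => h.trans h'⟩
      add' := by
        intro a b c d h1 h2
        show (a + c) • m = (b + d) • m
        rw [add_smul, add_smul, h1, h2]
      smul := by
        intro s a b h1
        show (s • a) • m = (s • b) • m
        rw [smul_assoc, smul_assoc, h1] }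
  obtain ⟨e, he, hr⟩ := h r
  replace he : e • m = (1 : S) • m := he
  have hs : ∀ x : M, ∃ a : S, a • m = x := fun x =>
    Submodule.mem_span_singleton.1 (hm ▸ Submodule.mem_top : x ∈ Submodule.span S {m})
  choose c hc using hs
  let i : M →ₗ[S] S :=
    { toFun := fun x => c x * e
      map_add' := by
        intro x y
        rw [← add_mul]
        apply hr
        show _ • m = _ • m
        rw [add_smul, hc, hc, hc]
      map_smul' := by
        intro s x
        show c (s • x) * e = s * (c x * e)
        rw [← mul_assoc]
        apply hr
        show _ • m = _ • m
        rw [mul_smul, hc, hc] }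
  refine Module.Projective.of_split i (LinearMap.toSpanSingleton S M m) ?_
  ext x
  show (c x * e) • m = x
  rw [mul_smul, he, one_smul, hc]

theorem LCProp.of_surj {S T : Type u} [Semiring S] [Semiring T] (f : S →+* T)
    (hf : Function.Surjective f) (h : LCProp S) : LCProp T := by
  intro r
  obtain ⟨e, he, hr⟩ := h
    { r := fun a b => r.r (f a) (f b)
      iseqv := ⟨fun _ => r.iseqv.refl _, fun h => r.iseqv.symm h, fun h h' => r.iseqv.trans h h'⟩
      add' := by
        intro a b c d h1 h2
        have := r.add' h1 h2
        simpa using this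
      smul := by
        intro s a b h1
        have := r.smul (f s) h1
        simpa using this }
  refine ⟨f e, by simpa using he, ?_⟩
  intro a b hab
  obtain ⟨a, rfl⟩ := hf a
  obtain ⟨b, rfl⟩ := hf b
  rw [← map_mul, ← map_mul, hr a b hab]

theorem LCProp.prod {R T : Type u} [Semiring R] [Semiring T] (hR : LCProp R) (hT : LCProp T) :
    LCProp (R × T) := by
  intro r
  obtain ⟨e, he, hr⟩ := hR
    { r := fun a b => r.r (a, 0) (b, 0)
      iseqv := ⟨fun _ => r.iseqv.refl _, fun h => r.iseqv.symm h, fun h h' => r.iseqv.trans h h'⟩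
      add' := by
        intro a b c d h1 h2
        have := r.add' h1 h2
        simpa using this
      smul := by
        intro s a b h1
        have := r.smul (s, 0) h1
        simpa using this }
  obtain ⟨f, hf, hr'⟩ := hT
    { r := fun a b => r.r (0, a) (0, b)
      iseqv := ⟨fun _ => r.iseqv.refl _, fun h => r.iseqv.symm h, fun h h' => r.iseqv.trans h h'⟩
      add' := by
        intro a b c d h1 h2
        have := r.add' h1 h2
        simpa using this
      smul := by
        intro s a b h1
        have := r.smul (0, s) h1
        simpa using this }
  refine ⟨(e, f), ?_, ?_⟩
  · have := r.add' he hf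
    show r.r (e, f) (1, 1)
    simpa using this
  · rintro ⟨a, a'⟩ ⟨b, b'⟩ hab
    have h1 := r.smul (1, 0) hab
    have h2 := r.smul (0, 1) hab
    have h3 := hr a b (by simpa using h1)
    have h4 := hr' a' b' (by simpa using h2)
    simp [h3, h4]

theorem LCProp.semisimple {R : Type u} [Ring R] (h : LCProp R) : IsSemisimpleRing R := by
  refine (isSemisimpleModule_iff R R).2 ⟨fun I => ?_⟩
  obtain ⟨e, he, hr⟩ := h
    { r := fun a b => a - b ∈ I
      iseqv := ⟨fun a => by simp, fun {a b} h => by simpa using I.neg_mem h,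
        fun {a b c} h h' => by simpa using I.add_mem h h'⟩
      add' := by
        intro a b c d h1 h2
        show (a + c) - (b + d) ∈ I
        rw [add_sub_add_comm]
        exact I.add_mem h1 h2
      smul := by
        intro s a b h1
        show s • a - s • b ∈ I
        rw [← smul_sub]
        exact I.smul_mem s h1 }
  replace he : e - 1 ∈ I := he
  have h0 : ∀ a ∈ I, a * e = 0 := fun a ha => by
    simpa using hr a 0 (show a - 0 ∈ I by simpa using ha)
  have hee : e * e = e := by
    have := h0 _ he
    rwa [sub_mul, one_mul, sub_eq_zero] at this
  refine ⟨Submodule.span R {e}, ?_⟩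
  rw [isCompl_iff]
  constructor
  · rw [Submodule.disjoint_def]
    intro x hx hx'
    obtain ⟨a, rfl⟩ := Submodule.mem_span_singleton.1 hx'
    have := h0 _ hx
    rwa [smul_eq_mul, mul_assoc, hee] at this
  · rw [codisjoint_iff, eq_top_iff]
    intro x _
    rw [Submodule.mem_sup]
    refine ⟨-(x • (e - 1)), I.neg_mem (I.smul_mem _ he), x • e,
      Submodule.smul_mem _ _ (Submodule.mem_span_singleton_self e), ?_⟩
    simp [mul_sub]

theorem semisimple_cp {R : Type u} [Ring R] [IsSemisimpleRing R] : IsLeftCPSemiring R := by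
  intro M _ _ _
  let _ : AddCommGroup M := Module.addCommMonoidToAddCommGroup R
  exact Module.projective_of_isSemisimpleRing R M

/-- The archimedean congruence. -/
def archCon (S : Type u) [Semiring S] : ModuleCon S S where
  r a b := (∃ n : ℕ, 1 ≤ n ∧ ∃ c, n • a = b + c) ∧ (∃ n : ℕ, 1 ≤ n ∧ ∃ c, n • b = a + c)
  iseqv := by
    have tr : ∀ a b c : S, (∃ n : ℕ, 1 ≤ n ∧ ∃ d, n • a = b + d) →
        (∃ n : ℕ, 1 ≤ n ∧ ∃ d, n • b = c + d) → (∃ n : ℕ, 1 ≤ n ∧ ∃ d, n • a = c + d) := by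
      rintro a b c ⟨n, hn, d, hd⟩ ⟨m, hm, d', hd'⟩
      refine ⟨m * n, Nat.mul_pos hm hn, d' + m • d, ?_⟩
      rw [mul_smul, hd, smul_add, hd', add_assoc]
    refine ⟨fun a => ⟨⟨1, le_rfl, 0, by simp⟩, ⟨1, le_rfl, 0, by simp⟩⟩, fun h => ⟨h.2, h.1⟩, ?_⟩
    intro a b c h h'
    exact ⟨tr _ _ _ h.1 h'.1, tr _ _ _ h'.2 h.2⟩
  add' := by
    have tr : ∀ a b a' b' : S, (∃ n : ℕ, 1 ≤ n ∧ ∃ d, n • a = b + d) →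
        (∃ n : ℕ, 1 ≤ n ∧ ∃ d, n • a' = b' + d) →
        (∃ n : ℕ, 1 ≤ n ∧ ∃ d, n • (a + a') = (b + b') + d) := by
      rintro a b a' b' ⟨n, hn, d, hd⟩ ⟨m, hm, d', hd'⟩
      refine ⟨n + m, by omega, (d + m • a) + (d' + n • a'), ?_⟩
      calc (n + m) • (a + a') = (n • a + m • a) + (m • a' + n • a') := by
            rw [add_smul, smul_add, smul_add]; abel
        _ = _ := by rw [hd, hd']; abel
    intro a b a' b' h h'
    exact ⟨tr _ _ _ _ h.1 h'.1, tr _ _ _ _ h.2 h'.2⟩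
  smul := by
    have tr : ∀ s a b : S, (∃ n : ℕ, 1 ≤ n ∧ ∃ d, n • a = b + d) →
        (∃ n : ℕ, 1 ≤ n ∧ ∃ d, n • (s * a) = s * b + d) := by
      rintro s a b ⟨n, hn, d, hd⟩
      exact ⟨n, hn, s * d, by rw [← mul_smul_comm, hd, mul_add]⟩
    intro s a b h
    exact ⟨tr _ _ _ h.1, tr _ _ _ h.2⟩

/-- The cancellation congruence. -/
def cancCon (S : Type u) [Semiring S] : ModuleCon S S where
  r a b := ∃ m, a + m = b + m
  iseqv := by
    refine ⟨fun a => ⟨0, rfl⟩, fun ⟨m, h⟩ => ⟨m, h.symm⟩, ?_⟩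
    rintro a b c ⟨m, h⟩ ⟨m', h'⟩
    refine ⟨m + m', ?_⟩
    rw [← add_assoc, h, add_right_comm, h']; abel
  add' := by
    rintro a b a' b' ⟨m, h⟩ ⟨m', h'⟩
    exact ⟨m + m', by rw [add_add_add_comm, h, h', add_add_add_comm]⟩
  smul := by
    rintro s a b ⟨m, h⟩
    exact ⟨s * m, by simp only [smul_eq_mul]; rw [← mul_add, h, mul_add]⟩

theorem LCProp.arch {S : Type u} [Semiring S] (h : LCProp S) :
    ∃ c d : S, ∃ n : ℕ, 1 ≤ n ∧ (1 + c) + (1 + c) = 1 + c ∧ n • (1 : S) = (1 + c) + d := by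
  obtain ⟨e, ⟨⟨n, hn, c, hc⟩, ⟨m, hm, d, hd⟩⟩, hr⟩ := h (archCon S)
  have h2 : e + e = e := by
    have := hr (1 + 1) 1 ⟨⟨1, le_rfl, 1, by simp⟩, ⟨2, by omega, 0, by simp [two_smul]⟩⟩
    simpa [add_mul] using this
  have hk : ∀ k : ℕ, (k + 1) • e = e := by
    intro k
    induction k with
    | zero => simp
    | succ k ih => rw [add_smul, ih, one_smul, h2]
  obtain ⟨k, rfl⟩ : ∃ k, n = k + 1 := ⟨n - 1, by omega⟩
  rw [hk] at hc
  exact ⟨c, d, m, hm, by rw [← hc, h2], by rw [← hc, hd]⟩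

theorem LCProp.pireg {S : Type u} [Semiring S] (h : LCProp S) :
    ∃ n : ℕ, 1 ≤ n ∧ ∃ y : S, n • (1 : S) = n • (1 : S) + y + n • (1 : S) := by
  obtain ⟨c, d, n, hn, hc, hd⟩ := h.arch
  have h1 : n • (1 : S) + (1 + c) = n • (1 : S) := by
    rw [hd, add_right_comm, hc]
  have hk : ∀ k : ℕ, n • (1 : S) + k • (1 + c) = n • (1 : S) := by
    intro k
    induction k with
    | zero => simp
    | succ k ih => rw [add_smul, one_smul, ← add_assoc, ih, h1]
  refine ⟨n, hn, n • c, ?_⟩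
  conv_lhs => rw [← hk n]
  rw [smul_add]; abel

theorem LCProp.idem {S : Type u} [Semiring S] (h : LCProp S) :
    ∃ e f c m : S, e * e = e ∧ f * f = f ∧ e * f = 0 ∧ f * e = 0 ∧ e + f = 1 ∧
      (∀ s, e * s = s * e) ∧ e + c * e = 0 ∧ f + m = m := by
  obtain ⟨c, -, -, -, hc, -⟩ := h.arch
  obtain ⟨e, ⟨m, hm⟩, hr⟩ := h (cancCon S)
  have hr' : ∀ a b m, a + m = b + m → a * e = b * e := fun a b m h => hr a b ⟨m, h⟩
  have h0 : e + c * e = 0 := by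
    have := hr' (1 + c) 0 (1 + c) (by rw [hc, zero_add])
    simpa [add_mul] using this
  have hse : ∀ s, e * s * e = s * e := fun s => hr' _ _ (m * s) (by
    rw [← add_mul, hm, add_mul, one_mul])
  have hee : e * e = e := by simpa using hr' _ _ m hm
  have hef1 : e + (1 + c * e) = 1 := by rw [add_left_comm, h0, add_zero]
  have hef : e * (1 + c * e) = 0 := by
    rw [mul_add, mul_one, ← mul_assoc, hse, h0]
  have hfe : (1 + c * e) * e = 0 := by
    rw [add_mul, one_mul, mul_assoc, hee, h0]
  have hfm : (1 + c * e) + m = m := by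
    calc (1 + c * e) + m = (1 + m) + c * e := by abel
      _ = (e + m) + c * e := by rw [hm]
      _ = (e + c * e) + m := by abel
      _ = m := by rw [h0, zero_add]
  generalize 1 + c * e = f at *
  have hff : f * f = f := by
    calc f * f = f * e + f * f := by rw [hfe, zero_add]
      _ = f := by rw [← mul_add, hef1, mul_one]
  have hesf : ∀ s, e * s * f = 0 := by
    intro s
    have h1 : e * s * f + e * s * f * m = e * s * f * m := by
      have : e * s * f * (f + m) = e * s * f * m := by rw [hfm]
      rwa [mul_add, mul_assoc (e * s) f f, hff] at this
    have h2 : e * s * f * m + c * (e * s * f * m) = 0 := by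
      have : (e + c * e) * (s * f * m) = 0 := by rw [h0, zero_mul]
      simpa [add_mul, mul_assoc] using this
    calc e * s * f = e * s * f + (e * s * f * m + c * (e * s * f * m)) := by rw [h2, add_zero]
      _ = 0 := by rw [← add_assoc, h1, h2]
  refine ⟨e, f, c, m, hee, hff, hef, hfe, hef1, ?_, h0, hfm⟩
  intro s
  calc e * s = e * s * (e + f) := by rw [hef1, mul_one]
    _ = s * e := by rw [mul_add, hesf, add_zero, hse]

/-- A semiring in which `1` has an additive inverse is a ring. -/
@[reducible] def ringOfNegOne {R : Type u} [inst : Semiring R] (g : R) (hg : g + 1 = 0) : Ring R :=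
  letI : Neg R := ⟨fun x => g * x⟩
  { inst with
    neg := fun x => g * x
    zsmul := zsmulRec
    neg_add_cancel := fun x => by
      show g * x + x = 0
      have : (g + 1) * x = 0 := by rw [hg, zero_mul]
      rwa [add_mul, one_mul] at this }

theorem LCProp.decomp {S : Type u} [Semiring S] (h : LCProp S) :
    ∃ (R : Type u) (T : Type u) (_ : Ring R) (_ : Semiring T),
      Nonempty (S ≃+* R × T) ∧ (∀ t : T, ∃ m : T, t + m = m) := by
  obtain ⟨e, f, c, m, hee, hff, hef, hfe, hef1, hcen, h0, hfm⟩ := h.idem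
  have hcenf : ∀ s, f * s = s * f := by
    intro s
    have h1 : f * s * e = 0 := by rw [mul_assoc, ← hcen, ← mul_assoc, hfe, zero_mul]
    have h2 : e * (s * f) = 0 := by rw [hcen, mul_assoc, hfe, mul_zero]
    calc f * s = f * s * (e + f) := by rw [hef1, mul_one]
      _ = f * s * f := by rw [mul_add, h1, zero_add]
      _ = (e + f) * (s * f) := by rw [add_mul, h2, zero_add, mul_assoc]
      _ = s * f := by rw [hef1, one_mul]
  have ie : IsIdempotentElem e := hee
  have jf : IsIdempotentElem f := hff
  let φ : S →+* ie.Corner × jf.Corner :=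
    { toFun := fun s => (⟨e * s * e, s, rfl⟩, ⟨f * s * f, s, rfl⟩)
      map_one' := Prod.ext (Subtype.ext (show e * 1 * e = e by rw [mul_one, hee]))
        (Subtype.ext (show f * 1 * f = f by rw [mul_one, hff]))
      map_zero' := Prod.ext (Subtype.ext (show e * 0 * e = 0 by simp))
        (Subtype.ext (show f * 0 * f = 0 by simp))
      map_add' := fun a b => Prod.ext
        (Subtype.ext (show e * (a + b) * e = e * a * e + e * b * e by rw [mul_add, add_mul]))
        (Subtype.ext (show f * (a + b) * f = f * a * f + f * b * f by rw [mul_add, add_mul]))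
      map_mul' := fun a b => Prod.ext
        (Subtype.ext (show e * (a * b) * e = (e * a * e) * (e * b * e) by
          simp only [hcen, mul_assoc, hee]))
        (Subtype.ext (show f * (a * b) * f = (f * a * f) * (f * b * f) by
          simp only [hcenf, mul_assoc, hff])) }
  have hφ : Function.Bijective φ := by
    constructor
    · intro a b hab
      have h1 : e * a * e = e * b * e := congrArg (fun x => x.1.1) hab
      have h2 : f * a * f = f * b * f := congrArg (fun x => x.2.1) hab
      rw [hcen, hcen b, mul_assoc, mul_assoc, hee] at h1
      rw [hcenf, hcenf b, mul_assoc, mul_assoc, hff] at h2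
      rw [← mul_one a, ← mul_one b, ← hef1, mul_add, mul_add, h1, h2]
    · rintro ⟨⟨_, a, rfl⟩, ⟨_, b, rfl⟩⟩
      refine ⟨e * a * e + f * b * f, Prod.ext (Subtype.ext ?_) (Subtype.ext ?_)⟩
      · show e * (e * a * e + f * b * f) * e = e * a * e
        have : e * (f * b * f) = 0 := by rw [← mul_assoc, ← mul_assoc, hef]; simp
        rw [mul_add, this, add_zero, mul_assoc e a e, ← mul_assoc e e, hee, mul_assoc, mul_assoc,
          hee]
      · show f * (e * a * e + f * b * f) * f = f * b * f
        have : f * (e * a * e) = 0 := by rw [← mul_assoc, ← mul_assoc, hfe]; simp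
        rw [mul_add, this, zero_add, mul_assoc f b f, ← mul_assoc f f, hff, mul_assoc, mul_assoc,
          hff]
  let g : ie.Corner := ⟨e * c * e, c, rfl⟩
  have hg : g + 1 = 0 := Subtype.ext (show e * c * e + e = 0 by
    rw [hcen, mul_assoc, hee, add_comm, h0])
  refine ⟨ie.Corner, jf.Corner, ringOfNegOne g hg, inferInstance,
    ⟨RingEquiv.ofBijective φ hφ⟩, ?_⟩
  intro t
  let m' : jf.Corner := ⟨f * m * f, m, rfl⟩
  have hm' : 1 + m' = m' := Subtype.ext (show f + f * m * f = f * m * f by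
    have : f * (f + m) * f = f * m * f := by rw [hfm]
    rwa [mul_add, add_mul, hff, hff] at this)
  refine ⟨t * m', ?_⟩
  calc t + t * m' = t * (1 + m') := by rw [mul_add, mul_one]
    _ = t * m' := by rw [hm']

/-- a semiring `S` is a left CP-semiring iff `S ≅ R × T` where `R` is
a semisimple ring and `T` is a zeroic, additively π-regular left CP-semiring. -/
theorem isLeftCPSemiring_iff_semisimple_prod_zeroic
    (S : Type u) [Semiring S] :
    IsLeftCPSemiring S ↔
      ∃ (R : Type u) (T : Type u) (_ : Ring R) (_ : Semiring T),
        Nonempty (S ≃+* R × T) ∧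
        IsSemisimpleRing R ∧
        (∀ t : T, ∃ m : T, t + m = m) ∧
        (∃ n : ℕ, 1 ≤ n ∧ ∃ y : T, n • (1 : T) = n • (1 : T) + y + n • (1 : T)) ∧
        IsLeftCPSemiring T := by
  constructor
  · intro h
    have hS := LCProp.of_cp h
    obtain ⟨R, T, _, _, ⟨φ⟩, hz⟩ := hS.decomp
    have hR : LCProp R := hS.of_surj ((RingHom.fst R T).comp φ.toRingHom)
      (Prod.fst_surjective.comp φ.surjective)
    have hT : LCProp T := hS.of_surj ((RingHom.snd R T).comp φ.toRingHom)
      (Prod.snd_surjective.comp φ.surjective)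
    exact ⟨R, T, _, _, ⟨φ⟩, hR.semisimple, hz, hT.pireg, hT.cp⟩
  · rintro ⟨R, T, _, _, ⟨φ⟩, hR, -, -, hT⟩
    exact (((LCProp.of_cp semisimple_cp).prod (LCProp.of_cp hT)).of_surj
      φ.symm.toRingHom φ.symm.surjective).cp
end

section
/- Let S be a semiring and n ≥ 1. There exists an order isomorphism χ from the lattice of semiring congruences RingCon S to RingCon (Matrix (Fin n) (Fin n) S) such that for every θ : RingCon S and all matrices A, B, one has (χ θ) A B if and only if θ (A i j) (B i j) for all indices i, j; moreover, for every θ : RingCon S the quotient semiring (χ θ).Quotient is isomorphic as a semiring to Matrix (Fin n) (Fin n) θ.Quotient. -/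
universe u

/-- the congruence lattices of a semiring `S` and of the matrix
semiring `Matrix (Fin n) (Fin n) S` are isomorphic via entrywise comparison of
matrices, and corresponding quotients are isomorphic: `T/Θ ≅ Mₙ(S/θ)`. -/
theorem ringCon_matrix_orderIso
    (S : Type u) [Semiring S] (n : ℕ) (hn : 1 ≤ n) :
    ∃ χ : RingCon S ≃o RingCon (Matrix (Fin n) (Fin n) S),
      (∀ (θ : RingCon S) (A B : Matrix (Fin n) (Fin n) S),
        (χ θ) A B ↔ ∀ i j, θ (A i j) (B i j)) ∧
      (∀ θ : RingCon S,
        Nonempty ((χ θ).Quotient ≃+* Matrix (Fin n) (Fin n) θ.Quotient)) := by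
  haveI : Nonempty (Fin n) := ⟨⟨0, hn⟩⟩
  refine ⟨
    { toFun := RingCon.matrix (Fin n)
      invFun := RingCon.ofMatrix
      left_inv := fun c => RingCon.ofMatrix_matrix c
      right_inv := fun c => RingCon.matrix_ofMatrix c
      map_rel_iff' := fun {a b} => ⟨fun h x y hxy => ?_, fun h => RingCon.matrix_monotone _ h⟩ },
    fun θ A B => Iff.rfl, fun θ => ?_⟩
  · exact (RingCon.matrix_apply (Fin n)).1
      (h (show RingCon.matrix (Fin n) a (Matrix.of fun _ _ => x) (Matrix.of fun _ _ => y) from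
        fun _ _ => hxy)) ⟨0, hn⟩ ⟨0, hn⟩
  · change Nonempty ((RingCon.matrix (Fin n) θ).Quotient ≃+* Matrix (Fin n) (Fin n) θ.Quotient)
    let f : Matrix (Fin n) (Fin n) S →+* Matrix (Fin n) (Fin n) θ.Quotient := θ.mk'.mapMatrix
    have hf : ∀ A B, RingCon.matrix (Fin n) θ A B ↔ f A = f B := fun A B =>
      ⟨fun h => Matrix.ext fun i j => (RingCon.eq θ).2 (h i j),
       fun h i j => (RingCon.eq θ).1 (congrFun (congrFun h i) j)⟩
    refine ⟨RingEquiv.ofBijective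
      ((RingCon.matrix (Fin n) θ).lift f (fun A B h => (hf A B).1 h)) ⟨?_, ?_⟩⟩
    · intro x y
      obtain ⟨A, rfl⟩ := RingCon.mk'_surjective _ x
      obtain ⟨B, rfl⟩ := RingCon.mk'_surjective _ y
      intro h
      exact (RingCon.eq _).2 ((hf A B).2 h)
    · intro M
      choose g hg using fun i j => RingCon.mk'_surjective θ (M i j)
      exact ⟨RingCon.mk' _ (Matrix.of g), Matrix.ext hg⟩
end

section
/- Let D be a division semiring (Mathlib's DivisionSemiring) and n ≥ 1. The matrix semiring Matrix (Fin n) (Fin n) D is a left CP-semiring if and only if either D is a division ring (every element of D has an additive inverse: ∀ d ∃ d', d + d' = 0), or D is isomorphic to the Boolean semifield B and n = 1 or n = 2. -/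
universe u

/-- `S` is (isomorphic to) the Boolean semifield `B = {0, 1}` with `1 + 1 = 1`. -/
def IsBooleanSemifield (S : Type u) [Semiring S] : Prop :=
  (∀ x : S, x = 0 ∨ x = 1) ∧ (0 : S) ≠ 1 ∧ (1 : S) + 1 = 1

/-- The splitting criterion, forward direction, in terms of congruences. -/
theorem cp_congr_split {S : Type u} [Semiring S] (h : IsLeftCPSemiring S)
    (c : ModuleCon S S) :
    ∃ t : S, c.r t 1 ∧ ∀ s s' : S, c.r s s' → s * t = s' * t := by
  let π : S →ₗ[S] c.Quotient :=
    { toFun := fun s => (Quotient.mk c.toSetoid s : Quotient c.toSetoid)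
      map_add' := fun _ _ => rfl
      map_smul' := fun _ _ => rfl }
  have hπ : Function.Surjective π := Quotient.mk_surjective
  have hsp : Submodule.span S {π 1} = ⊤ := by
    rw [eq_top_iff]
    intro x _
    obtain ⟨s, rfl⟩ := hπ x
    rw [Submodule.mem_span_singleton]
    exact ⟨s, by rw [← map_smul, smul_eq_mul, mul_one]⟩
  haveI := h c.Quotient ⟨π 1, hsp⟩
  obtain ⟨g, hg⟩ := Module.projective_lifting_property π LinearMap.id hπ
  refine ⟨g (π 1), ?_, ?_⟩
  · have : π (g (π 1)) = π 1 := LinearMap.congr_fun hg (π 1)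
    exact Quotient.exact this
  · intro s s' hs
    have e : π s = π s' := Quotient.sound hs
    rw [← smul_eq_mul, ← smul_eq_mul, ← map_smul, ← map_smul, ← map_smul, ← map_smul,
      smul_eq_mul, smul_eq_mul, mul_one, mul_one, e]

/-- The splitting criterion, backward direction. -/
theorem projective_of_split_elt {S : Type u} [Semiring S] {M : Type u} [AddCommMonoid M]
    [Module S M] (m : M) (hm : Submodule.span S {m} = ⊤) (t : S) (ht : t • m = m)
    (hs : ∀ s s' : S, s • m = s' • m → s * t = s' * t) : Module.Projective S M := by
  have hex : ∀ x : M, ∃ s : S, s • m = x := fun x => by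
    rw [← Submodule.mem_span_singleton, hm]; trivial
  choose f hf using hex
  let i : M →ₗ[S] S :=
    { toFun := fun x => f x * t
      map_add' := fun x y => by
        rw [← add_mul]; apply hs; rw [add_smul, hf, hf, hf]
      map_smul' := fun r x => by
        simp only [smul_eq_mul, RingHom.id_apply]
        rw [← mul_assoc]; apply hs; rw [mul_smul, hf, hf] }
  refine Module.Projective.of_split i (LinearMap.toSpanSingleton S M m) ?_
  ext x
  change (f x * t) • m = x
  rw [mul_smul, ht, hf]

/-- Division rings. -/
theorem cp_of_ring (D : Type u) [DivisionSemiring D] (n : ℕ)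
    (h : ∀ d : D, ∃ d' : D, d + d' = 0) : IsLeftCPSemiring (Matrix (Fin n) (Fin n) D) := by
  choose ng hng using h
  letI : Neg D := ⟨ng⟩
  letI : DivisionRing D :=
    { ‹DivisionSemiring D› with
      neg := ng
      neg_add_cancel := fun a => by rw [add_comm]; exact hng a
      zsmul := zsmulRec
      qsmul := _
      qsmul_def := fun _ _ => rfl }
  intro M _ _ _
  letI : AddCommGroup M := Module.addCommMonoidToAddCommGroup (Matrix (Fin n) (Fin n) D)
  exact Module.projective_of_isSemisimpleRing (Matrix (Fin n) (Fin n) D) M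

theorem cp_bool_one (D : Type u) [DivisionSemiring D] (hD : IsBooleanSemifield D) :
    IsLeftCPSemiring (Matrix (Fin 1) (Fin 1) D) := by
  rintro M _ _ ⟨m, hm⟩
  have key : ∀ s : Matrix (Fin 1) (Fin 1) D, s = 0 ∨ s = 1 := by
    intro s
    rcases hD.1 (s 0 0) with h | h
    · left; ext i j; rw [Subsingleton.elim i 0, Subsingleton.elim j 0]; simpa using h
    · right; ext i j; rw [Subsingleton.elim i 0, Subsingleton.elim j 0]; simpa using h
  by_cases h0 : m = 0
  · refine projective_of_split_elt m hm 0 ?_ ?_ <;> simp [h0]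
  · refine projective_of_split_elt m hm 1 ?_ ?_
    · simp
    · intro s s' h
      rcases key s with rfl | rfl <;> rcases key s' with rfl | rfl <;> simp_all [eq_comm]

theorem cp_bool_two (D : Type u) [DivisionSemiring D] (hD : IsBooleanSemifield D) :
    IsLeftCPSemiring (Matrix (Fin 2) (Fin 2) D) := by
  rintro M _ _ ⟨m, hm⟩
  obtain ⟨h01, hne, h11⟩ := hD
  let x : M := Matrix.single (0 : Fin 2) (0 : Fin 2) (1 : D) • m
  let y : M := Matrix.single (0 : Fin 2) (1 : Fin 2) (1 : D) • m
  let ρ : D → D → M := fun a b =>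
    Matrix.single (0 : Fin 2) (0 : Fin 2) a • m + Matrix.single (0 : Fin 2) (1 : Fin 2) b • m
  have hrow : ∀ (s : Matrix (Fin 2) (Fin 2) D) (i : Fin 2),
      Matrix.single (0 : Fin 2) i (1 : D) • s • m = ρ (s i 0) (s i 1) := by
    intro s i
    simp only [ρ]
    rw [smul_smul, ← add_smul]
    congr 1
    ext a b
    fin_cases a <;> fin_cases b <;> fin_cases i <;>
      simp [Matrix.mul_apply, Matrix.single]
  have hone : (1 : Matrix (Fin 2) (Fin 2) D) =
      Matrix.single 0 0 1 * Matrix.single 0 0 1 + Matrix.single 1 0 1 * Matrix.single 0 1 1 := by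
    ext a b
    fin_cases a <;> fin_cases b <;> simp [Matrix.mul_apply, Matrix.single]
  have hrec : ∀ z : M, z = Matrix.single (0 : Fin 2) (0 : Fin 2) (1 : D) •
        Matrix.single (0 : Fin 2) (0 : Fin 2) (1 : D) • z +
      Matrix.single (1 : Fin 2) (0 : Fin 2) (1 : D) •
        Matrix.single (0 : Fin 2) (1 : Fin 2) (1 : D) • z := by
    intro z
    rw [smul_smul, smul_smul, ← add_smul, ← hone, one_smul]
  have r00 : ρ 0 0 = 0 := by simp [ρ]
  have r10 : ρ 1 0 = x := by simp [ρ, x]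
  have r01 : ρ 0 1 = y := by simp [ρ, y]
  have r11 : ρ 1 1 = x + y := by simp [ρ, x, y]
  have hxx : x + x = x := by
    simp only [x]; rw [← add_smul, ← Matrix.single_add, h11]
  have hyy : y + y = y := by
    simp only [y]; rw [← add_smul, ← Matrix.single_add, h11]
  clear_value x y
  -- reduction to a statement on rows
  have main : ∀ t : Matrix (Fin 2) (Fin 2) D, ρ (t 0 0) (t 0 1) = x → ρ (t 1 0) (t 1 1) = y →
      (∀ a b c d : D, ρ a b = ρ c d → a * t 0 0 + b * t 1 0 = c * t 0 0 + d * t 1 0 ∧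
        a * t 0 1 + b * t 1 1 = c * t 0 1 + d * t 1 1) →
        Module.Projective (Matrix (Fin 2) (Fin 2) D) M := by
    intro t ht0 ht1 ht
    refine projective_of_split_elt m hm t ?_ ?_
    · rw [hrec (t • m), hrow, hrow, ht0, ht1]
      conv_rhs => rw [← one_smul (Matrix (Fin 2) (Fin 2) D) m, hrec ((1 : Matrix _ _ D) • m),
        hrow, hrow]
      simp [r10, r01]
    · intro s s' hs
      have hr : ∀ i, ρ (s i 0) (s i 1) = ρ (s' i 0) (s' i 1) := by
        intro i
        rw [← hrow, ← hrow, hs]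
      ext i j
      have := ht _ _ _ _ (hr i)
      fin_cases j
      · simpa [Matrix.mul_apply] using this.1
      · simpa [Matrix.mul_apply] using this.2
  clear hrec hrow hone hm
  clear_value ρ
  have hxy0 : x + y = 0 → x = 0 := by
    intro h
    calc x = x + (x + y) := by rw [h, add_zero]
      _ = 0 := by rw [← add_assoc, hxx, h]
  by_cases hx : x = 0
  · by_cases hy : y = 0
    · refine main 0 ?_ ?_ ?_ <;> clear main <;> simp_all
    · refine main !![0, 0; 0, 1] ?_ ?_ ?_ <;> clear main
      · simp_all
      · simp_all
      · intro a b c d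
        rcases h01 a with rfl | rfl <;> rcases h01 b with rfl | rfl <;>
        rcases h01 c with rfl | rfl <;> rcases h01 d with rfl | rfl <;>
        simp [r00, r01, r10, r11, h11] <;> grind
  by_cases hy : y = 0
  · refine main !![1, 0; 0, 0] ?_ ?_ ?_ <;> clear main
    · simp_all
    · simp_all
    · intro a b c d
      rcases h01 a with rfl | rfl <;> rcases h01 b with rfl | rfl <;>
      rcases h01 c with rfl | rfl <;> rcases h01 d with rfl | rfl <;>
      simp [r00, r01, r10, r11, h11] <;> grind
  by_cases hxy : x = y
  · refine main !![1, 0; 1, 0] ?_ ?_ ?_ <;> clear main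
    · simp_all
    · simp_all
    · intro a b c d
      rcases h01 a with rfl | rfl <;> rcases h01 b with rfl | rfl <;>
      rcases h01 c with rfl | rfl <;> rcases h01 d with rfl | rfl <;>
      simp [r00, r01, r10, r11, h11] <;> grind
  by_cases h1 : x + y = y
  · refine main !![1, 0; 1, 1] ?_ ?_ ?_ <;> clear main
    · simp_all
    · simp_all
    · intro a b c d
      rcases h01 a with rfl | rfl <;> rcases h01 b with rfl | rfl <;>
      rcases h01 c with rfl | rfl <;> rcases h01 d with rfl | rfl <;>
      simp [r00, r01, r10, r11, h11] <;> grind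
  by_cases h2 : x + y = x
  · refine main !![1, 1; 0, 1] ?_ ?_ ?_ <;> clear main
    · simp_all
    · simp_all
    · intro a b c d
      rcases h01 a with rfl | rfl <;> rcases h01 b with rfl | rfl <;>
      rcases h01 c with rfl | rfl <;> rcases h01 d with rfl | rfl <;>
      simp [r00, r01, r10, r11, h11] <;> grind
  · have h3 : x + y ≠ 0 := fun h => hx (hxy0 h)
    refine main 1 ?_ ?_ ?_ <;> clear main
    · simp_all
    · simp_all
    · intro a b c d
      rcases h01 a with rfl | rfl <;> rcases h01 b with rfl | rfl <;>
      rcases h01 c with rfl | rfl <;> rcases h01 d with rfl | rfl <;>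
      simp [r00, r01, r10, r11, h11] <;> grind

/-- Zero-sum-free case: CP forces `D` Boolean. -/
theorem bool_of_cp (D : Type u) [DivisionSemiring D] (n : ℕ) (hn : 1 ≤ n)
    (hz : ∀ a b : D, a + b = 0 → a = 0)
    (h : IsLeftCPSemiring (Matrix (Fin n) (Fin n) D)) : IsBooleanSemifield D := by
  have hz' : ∀ a b : D, a + b = 0 ↔ a = 0 ∧ b = 0 := fun a b =>
    ⟨fun e => ⟨hz a b e, hz b a (by rwa [add_comm])⟩, fun e => by simp [e.1, e.2]⟩
  have hsum : ∀ (f : Fin n → D) (T : Finset (Fin n)), ∑ i ∈ T, f i = 0 ↔ ∀ i ∈ T, f i = 0 := by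
    intro f T
    induction T using Finset.induction_on with
    | empty => simp
    | insert a T ha ih => rw [Finset.sum_insert ha, hz', ih]; simp
  let k : Fin n := ⟨0, hn⟩
  let c : ModuleCon (Matrix (Fin n) (Fin n) D) (Matrix (Fin n) (Fin n) D) :=
    { r := fun s s' => ∀ i, s i k = 0 ↔ s' i k = 0
      iseqv := ⟨fun _ _ => Iff.rfl, fun h i => (h i).symm, fun h h' i => (h i).trans (h' i)⟩
      add' := by
        intro a b c d h1 h2 i
        rw [Matrix.add_apply, Matrix.add_apply, hz', hz', h1 i, h2 i]
      smul := by
        intro r s s' h1 i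
        simp only [smul_eq_mul, Matrix.mul_apply, hsum, mul_eq_zero, h1] }
  obtain ⟨t, ht1, ht⟩ := cp_congr_split h c
  have htk : t k k ≠ 0 := by
    have := ht1 k
    simp at this
    exact this
  have huniq : ∀ d : D, d ≠ 0 → d = 1 := by
    intro d hd
    have e := ht (Matrix.diagonal fun _ => d) 1 (by
      intro i
      by_cases hik : i = k
      · subst hik; simp [hd]
      · simp [hik])
    have e' := congrFun (congrFun e k) k
    rw [Matrix.diagonal_mul, one_mul] at e'
    exact mul_right_cancel₀ htk (by rw [e', one_mul])
  refine ⟨fun x => ?_, zero_ne_one, huniq _ fun e => one_ne_zero (hz 1 1 e)⟩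
  by_cases hx : x = 0
  · exact Or.inl hx
  · exact Or.inr (huniq x hx)

/-- `n ≥ 3` is impossible in the Boolean case. -/
theorem le_two_of_cp (D : Type u) [DivisionSemiring D] (n : ℕ) (hn : 3 ≤ n)
    (hD : IsBooleanSemifield D) (hz : ∀ a b : D, a + b = 0 → a = 0)
    (h : IsLeftCPSemiring (Matrix (Fin n) (Fin n) D)) : False := by
  have hz2 : ∀ a b : D, a + b = 0 → b = 0 := fun a b e => hz b a (by rwa [add_comm])
  obtain ⟨i, j, k, hij, hik, hjk⟩ : ∃ i j k : Fin n, i ≠ j ∧ i ≠ k ∧ j ≠ k :=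
    ⟨⟨0, by omega⟩, ⟨1, by omega⟩, ⟨2, by omega⟩, by simp, by simp, by simp⟩
  let P : Matrix (Fin n) (Fin n) D := Matrix.single i j 1 + Matrix.single i k 1 +
    Matrix.single j i 1 + Matrix.single j k 1 + Matrix.single k i 1 + Matrix.single k j 1
  let c : ModuleCon (Matrix (Fin n) (Fin n) D) (Matrix (Fin n) (Fin n) D) :=
    { r := fun s s' => s * P = s' * P
      iseqv := ⟨fun _ => rfl, fun h => h.symm, fun h h' => h.trans h'⟩
      add' := by
        intro a b c d h1 h2
        rw [add_mul, add_mul, h1, h2]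
      smul := by
        intro r s s' h1
        simp only [smul_eq_mul, mul_assoc, h1] }
  obtain ⟨t, ht1, ht⟩ := cp_congr_split h c
  have ht1 : t * P = P := by
    have : t * P = 1 * P := ht1
    rwa [one_mul] at this
  have hPi : ∀ (s : Matrix (Fin n) (Fin n) D) a, (s * P) a i = s a j + s a k := by
    intro s a
    simp [P, mul_add, hij, hik]
  have hPj : ∀ (s : Matrix (Fin n) (Fin n) D) a, (s * P) a j = s a i + s a k := by
    intro s a
    simp [P, mul_add, hij.symm, hjk]
  have hPk : ∀ (s : Matrix (Fin n) (Fin n) D) a, (s * P) a k = s a i + s a j := by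
    intro s a
    simp [P, mul_add, hik.symm, hjk.symm]
  have hPo : ∀ (s : Matrix (Fin n) (Fin n) D) a b, b ≠ i → b ≠ j → b ≠ k → (s * P) a b = 0 := by
    intro s a b h1 h2 h3
    simp [P, mul_add, h1, h2, h3]
  have e1 : t i j = 0 := by
    apply hz _ (t i k); rw [← hPi, ht1]; simp [P, hij.symm, hik.symm]
  have e2 : t k j = 0 := by
    apply hz2 (t k i); rw [← hPk, ht1]; simp [P, hik, hjk]
  have e3 : t j k = 0 := by
    apply hz2 (t j i); rw [← hPj, ht1]; simp [P, hij, hjk.symm]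
  have e4 : t j j = 1 := by
    have : t j j + t j k = 1 := by
      rw [← hPi, ht1]; simp [P, hij, hik.symm, hjk.symm, hij.symm, hik, hjk]
    rwa [e3, add_zero] at this
  have e := ht (Matrix.single i i 1 + Matrix.single i j 1)
    (Matrix.single i i 1 + Matrix.single i k 1) (by
      change _ * P = _ * P
      ext a b
      by_cases h1 : b = i
      · subst h1; rw [hPi, hPi]
        simp [Matrix.single_apply, hij, hik, hjk, hjk.symm, hij.symm, hik.symm]
      by_cases h2 : b = j
      · subst h2; rw [hPj, hPj]
        rcases eq_or_ne i a with rfl | ha <;>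
        simp [Matrix.single_apply, hij, hik, hjk, hjk.symm, hij.symm, hik.symm, hD.2.2, *]
      by_cases h3 : b = k
      · subst h3; rw [hPk, hPk]
        rcases eq_or_ne i a with rfl | ha <;>
        simp [Matrix.single_apply, hij, hik, hjk, hjk.symm, hij.symm, hik.symm, hD.2.2, *]
      rw [hPo _ _ _ h1 h2 h3, hPo _ _ _ h1 h2 h3])
  have e' := congrFun (congrFun e i) j
  simp [add_mul, e1, e2, e4] at e'

/-- for a division semiring `D` and `n ≥ 1`, the matrix semiring
`Mₙ(D)` is a left CP-semiring iff `D` is a division ring, or `D ≅ B` and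
`n = 1` or `n = 2`. -/
theorem matrix_divisionSemiring_isLeftCPSemiring_iff
    (D : Type u) [DivisionSemiring D] (n : ℕ) (hn : 1 ≤ n) :
    IsLeftCPSemiring (Matrix (Fin n) (Fin n) D) ↔
      (∀ d : D, ∃ d' : D, d + d' = 0) ∨
      (IsBooleanSemifield D ∧ (n = 1 ∨ n = 2)) := by
  constructor
  · intro h
    by_cases hz : ∀ a b : D, a + b = 0 → a = 0
    · right
      have hD := bool_of_cp D n hn hz h
      refine ⟨hD, ?_⟩
      by_contra hc
      exact le_two_of_cp D n (by omega) hD hz h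
    · left
      push Not at hz
      obtain ⟨a, b, hab, ha⟩ := hz
      intro d
      refine ⟨d * a⁻¹ * b, ?_⟩
      calc d + d * a⁻¹ * b = d * a⁻¹ * (a + b) := by
            rw [mul_add, inv_mul_cancel_right₀ ha]
        _ = 0 := by rw [hab, mul_zero]
  · rintro (h | ⟨hD, rfl | rfl⟩)
    · exact cp_of_ring D n h
    · exact cp_bool_one D hD
    · exact cp_bool_two D hD
end

section
/- Let r be a natural number, and for each i ∈ Fin r let D i be a division semiring and n i ≥ 1 a natural number. Then the semisimple semiring S = Π i, Matrix (Fin (n i)) (Fin (n i)) (D i) (with componentwise operations) is a left CP-semiring if and only if for every i, either D i is a division ring (every element of D i has an additive inverse), or D i is isomorphic to the Boolean semifield B and n i = 1 or n i = 2. -/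
universe u

/-- Elementwise form of the left CP property, in terms of left congruences. -/
def CongProp (S : Type u) [Semiring S] : Prop :=
  ∀ r : S → S → Prop, Equivalence r →
    (∀ a b c d, r a b → r c d → r (a + c) (b + d)) →
    (∀ s a b, r a b → r (s * a) (s * b)) →
    ∃ e, r e 1 ∧ ∀ x y, r x y → x * e = y * e

theorem congProp_of_cp (S : Type u) [Semiring S] (h : IsLeftCPSemiring S) : CongProp S := by
  intro r hr hadd hmul
  let c : ModuleCon S S :=
    { r := r
      iseqv := hr
      add' := fun h1 h2 => hadd _ _ _ _ h1 h2
      smul := fun s _ _ h1 => hmul s _ _ h1 }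
  let f : S →ₗ[S] c.Quotient :=
    { toFun := fun x => (Quotient.mk c.toSetoid x : Quotient c.toSetoid)
      map_add' := fun _ _ => rfl
      map_smul' := fun _ _ => rfl }
  have hfs : Function.Surjective f := fun q => Quotient.exists_rep q
  have hf : ∀ x y, f x = f y ↔ r x y := fun x y =>
    ⟨fun h => Quotient.exact h, fun h => Quotient.sound h⟩
  have hp : Module.Projective S c.Quotient := by
    apply h
    refine ⟨f 1, ?_⟩
    rw [eq_top_iff]
    rintro q -
    obtain ⟨x, rfl⟩ := hfs q
    rw [Submodule.mem_span_singleton]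
    exact ⟨x, by rw [← map_smul]; simp⟩
  obtain ⟨g, hg⟩ := Module.projective_lifting_property f LinearMap.id hfs
  have hx : ∀ x, g (f x) = x * g (f 1) := by
    intro x
    rw [← smul_eq_mul, ← map_smul, ← map_smul]; simp
  refine ⟨g (f 1), ?_, ?_⟩
  · rw [← hf]; exact LinearMap.congr_fun hg (f 1)
  · intro x y hxy
    rw [← hx, ← hx, (hf x y).2 hxy]

theorem cp_of_congProp (S : Type u) [Semiring S] (h : CongProp S) : IsLeftCPSemiring S := by
  intro M _ _ ⟨m, hm⟩
  obtain ⟨e, he, hxy⟩ := h (fun x y => x • m = y • m)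
    ⟨fun _ => rfl, fun h => h.symm, fun h1 h2 => h1.trans h2⟩
    (fun a b c d h1 h2 => by simp only [add_smul, h1, h2])
    (fun s a b h1 => by simp only [mul_smul, h1])
  have hs : ∀ v : M, ∃ x : S, x • m = v := by
    intro v
    rw [← Submodule.mem_span_singleton, hm]; trivial
  choose g hg using hs
  let i : M →ₗ[S] S :=
    { toFun := fun v => g v * e
      map_add' := fun v w => by
        rw [← add_mul]; apply hxy; rw [add_smul]; simp only [hg]
      map_smul' := fun s v => by
        simp only [RingHom.id_apply, smul_eq_mul]
        rw [← mul_assoc]; apply hxy; rw [mul_smul]; simp only [hg] }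
  refine Module.Projective.of_split i (LinearMap.toSpanSingleton S M m) ?_
  ext v
  simp only [LinearMap.comp_apply, LinearMap.toSpanSingleton_apply, LinearMap.id_apply]
  change (g v * e) • m = v
  rw [mul_smul, he, one_smul, hg]

theorem rel_sum {S : Type*} [AddCommMonoid S] {ι : Type*} (r : S → S → Prop) (hr : Equivalence r)
    (hadd : ∀ a b c d, r a b → r c d → r (a + c) (b + d)) (s : Finset ι) (f g : ι → S)
    (h : ∀ i, r (f i) (g i)) : r (∑ i ∈ s, f i) (∑ i ∈ s, g i) := by
  classical
  induction s using Finset.induction_on with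
  | empty => simpa using hr.refl 0
  | insert a s ha ih => rw [Finset.sum_insert ha, Finset.sum_insert ha]; exact hadd _ _ _ _ (h a) ih

theorem congProp_pi {ι : Type} [Fintype ι] [DecidableEq ι] (S : ι → Type u) [∀ i, Semiring (S i)]
    (h : ∀ i, CongProp (S i)) : CongProp (∀ i, S i) := by
  intro r hr hadd hmul
  have key : ∀ i, ∃ e : S i, r (Pi.single i e) (Pi.single i 1) ∧
      ∀ x y : S i, r (Pi.single i x) (Pi.single i y) → x * e = y * e := by
    intro i
    apply h i (fun x y => r (Pi.single i x) (Pi.single i y))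
    · exact ⟨fun _ => hr.refl _, fun h => hr.symm h, fun h1 h2 => hr.trans h1 h2⟩
    · intro a b c d h1 h2
      simpa only [Pi.single_add] using hadd _ _ _ _ h1 h2
    · intro s a b h1
      simpa only [Pi.single_mul] using hmul (Pi.single i s) _ _ h1
  choose e he hxy using key
  refine ⟨e, ?_, ?_⟩
  · have := rel_sum r hr hadd Finset.univ (fun i => Pi.single i (e i)) (fun i => Pi.single i 1) he
    rw [Finset.univ_sum_single] at this
    have h1 : (∑ i, Pi.single i 1 : ∀ i, S i) = 1 := Finset.univ_sum_single (1 : ∀ i, S i)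
    rwa [h1] at this
  · intro x y h1
    funext i
    apply hxy
    have h2 := hmul (Pi.single i 1) _ _ h1
    have h3 : ∀ x : ∀ i, S i, Pi.single i 1 * x = Pi.single i (x i) := by
      intro x
      rw [← Pi.single_mul_left]; simp
    rwa [h3, h3] at h2

theorem congProp_semisimple (S : Type u) [Ring S] [IsSemisimpleRing S] : CongProp S := by
  intro r hr hadd hmul
  let I : Submodule S S :=
    { carrier := {x | r x 0}
      add_mem' := fun h1 h2 => by simpa using hadd _ _ _ _ h1 h2
      zero_mem' := hr.refl 0
      smul_mem' := fun s x h1 => by simpa using hmul s _ _ h1 }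
  have hI : ∀ x y, r x y → x - y ∈ I := by
    intro x y h
    have := hadd _ _ _ _ h (hr.refl (-y))
    change r (x - y) 0
    simpa [sub_eq_add_neg] using this
  obtain ⟨J, hJ⟩ := exists_isCompl I
  have h1 : (1 : S) ∈ I ⊔ J := by rw [hJ.sup_eq_top]; trivial
  obtain ⟨i, hi, j, hj, hij⟩ := Submodule.mem_sup.1 h1
  refine ⟨j, ?_, ?_⟩
  · have := hadd _ _ _ _ (hr.symm hi : r 0 i) (hr.refl j)
    rwa [zero_add, hij] at this
  · intro x y hxy
    have h2 := hI x y hxy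
    have h3 : (x - y) * j ∈ J := J.smul_mem _ hj
    have h4 : (x - y) * j ∈ I := by
      have h5 : (x - y) * j = (x - y) - (x - y) * i := by
        rw [eq_sub_iff_add_eq, ← mul_add, add_comm, hij, mul_one]
      rw [h5]
      exact I.sub_mem h2 (I.smul_mem _ hi)
    have h6 : (x - y) * j = 0 := by
      have := hJ.inf_eq_bot
      have h7 : (x - y) * j ∈ I ⊓ J := ⟨h4, h3⟩
      rw [this] at h7; simpa using h7
    rw [sub_mul, sub_eq_zero] at h6
    exact h6

theorem congProp_matrix_ring (D : Type u) [inst : DivisionSemiring D] (n : ℕ)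
    (h : ∀ d : D, ∃ d' : D, d + d' = 0) : CongProp (Matrix (Fin n) (Fin n) D) := by
  choose neg hneg using h
  let _ : Neg D := ⟨neg⟩
  let R : Ring D := { inst with
    neg := neg
    zsmul := zsmulRec
    neg_add_cancel := fun a => by rw [add_comm]; exact hneg a }
  let _ : DivisionRing D := { R, inst with
    qsmul := _
    ratCast := Rat.castRec }
  exact congProp_semisimple (Matrix (Fin n) (Fin n) D)

theorem congProp_matrix_of_row (D : Type u) [Semiring D] (n : ℕ)
    (h : ∀ r : (Fin n → D) → (Fin n → D) → Prop, Equivalence r →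
      (∀ a b c d, r a b → r c d → r (a + c) (b + d)) →
      ∃ e : Matrix (Fin n) (Fin n) D, (∀ j, r (e j) (Pi.single j 1)) ∧
        ∀ u v, r u v → Matrix.vecMul u e = Matrix.vecMul v e) :
    CongProp (Matrix (Fin n) (Fin n) D) := by
  intro r hr hadd hmul
  obtain ⟨e, he, hxy⟩ := h
    (fun u v => ∀ c : Fin n → D, r (Matrix.vecMulVec c u) (Matrix.vecMulVec c v))
    ⟨fun _ _ => hr.refl _, fun h c => hr.symm (h c), fun h1 h2 c => hr.trans (h1 c) (h2 c)⟩
    (fun a b c d h1 h2 x => by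
      simpa only [Matrix.vecMulVec_add] using hadd _ _ _ _ (h1 x) (h2 x))
  have hdec : ∀ A : Matrix (Fin n) (Fin n) D,
      ∑ j, Matrix.vecMulVec (Pi.single j 1) (A j) = A := by
    intro A
    ext i k
    simp [Matrix.sum_apply, Matrix.vecMulVec_apply, Pi.single_apply]
  refine ⟨e, ?_, ?_⟩
  · have := rel_sum r hr hadd Finset.univ (fun j => Matrix.vecMulVec (Pi.single j 1) (e j))
      (fun j => Matrix.vecMulVec (Pi.single j 1) ((1 : Matrix (Fin n) (Fin n) D) j))
      (fun j => by
        have h1 : (1 : Matrix (Fin n) (Fin n) D) j = Pi.single j 1 := by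
          ext k; simp [Matrix.one_apply, Pi.single_apply, eq_comm]
        simp only [h1]
        exact he j _)
    rwa [hdec, hdec] at this
  · intro x y h1
    have h2 : ∀ j, Matrix.vecMul (x j) e = Matrix.vecMul (y j) e := by
      intro j
      apply hxy
      intro c
      have h3 : ∀ A : Matrix (Fin n) (Fin n) D,
          Matrix.vecMulVec c (A j) = Matrix.vecMulVec c (Pi.single j 1) * A := by
        intro A
        ext i k
        simp [Matrix.mul_apply, Matrix.vecMulVec_apply, Pi.single_apply]
      rw [h3, h3]
      exact hmul _ _ _ h1
    ext i k
    exact congrFun (h2 i) k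

theorem congProp_bool (D : Type u) [DivisionSemiring D] (n : ℕ)
    (hB : IsBooleanSemifield D) (hn : n = 1 ∨ n = 2) : CongProp (Matrix (Fin n) (Fin n) D) := by
  obtain ⟨hD, h01, h11⟩ := hB
  apply congProp_matrix_of_row
  intro r hr hadd
  rcases hn with rfl | rfl
  · have hu : ∀ u : Fin 1 → D, u = 0 ∨ u = 1 := by
      intro u
      rcases hD (u 0) with h | h
      · left; ext i; fin_cases i; exact h
      · right; ext i; fin_cases i; exact h
    by_cases h : r 0 1
    · refine ⟨0, ?_, by simp⟩
      intro j
      have : (Pi.single j 1 : Fin 1 → D) = 1 := by ext i; fin_cases i; fin_cases j; simp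
      rw [this]; exact h
    · refine ⟨1, ?_, ?_⟩
      · intro j
        have : (1 : Matrix (Fin 1) (Fin 1) D) j = Pi.single j 1 := by
          ext i; fin_cases i; fin_cases j; simp
        rw [this]; exact hr.refl _
      · intro u v huv
        rcases hu u with rfl | rfl <;> rcases hu v with rfl | rfl
        · rfl
        · exact absurd huv h
        · exact absurd (hr.symm huv) h
        · rfl
  · have hu : ∀ u : Fin 2 → D, u = ![0, 0] ∨ u = ![1, 0] ∨ u = ![0, 1] ∨ u = ![1, 1] := by
      intro u
      have : u = ![u 0, u 1] := by ext i; fin_cases i <;> rfl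
      rw [this]
      rcases hD (u 0) with h | h <;> rcases hD (u 1) with h' | h' <;> simp [h, h']
    have hra : ∀ a b c d a' b' c' d' : D, r ![a, b] ![c, d] → r ![a', b'] ![c', d'] →
        r ![a + a', b + b'] ![c + c', d + d'] := by
      intro a b c d a' b' c' d' h1 h2
      simpa using hadd _ _ _ _ h1 h2
    -- adding a fixed vector
    have za : r ![0, 0] ![1, 0] → r ![0, 1] ![1, 1] := fun h => by
      simpa using hra _ _ _ _ _ _ _ _ h (hr.refl ![0, 1])
    have zb : r ![0, 0] ![0, 1] → r ![1, 0] ![1, 1] := fun h => by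
      simpa using hra _ _ _ _ _ _ _ _ h (hr.refl ![1, 0])
    have zta : r ![0, 0] ![1, 1] → r ![0, 0] ![1, 0] := fun h => by
      have := hra _ _ _ _ _ _ _ _ h (hr.refl ![1, 0])
      simp only [zero_add, h11, add_zero] at this
      exact hr.trans h (hr.symm this)
    have ztb : r ![0, 0] ![1, 1] → r ![0, 0] ![0, 1] := fun h => by
      have := hra _ _ _ _ _ _ _ _ h (hr.refl ![0, 1])
      simp only [zero_add, h11, add_zero] at this
      exact hr.trans h (hr.symm this)
    have aba : r ![1, 0] ![0, 1] → r ![1, 0] ![1, 1] := fun h => by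
      have := hra _ _ _ _ _ _ _ _ h (hr.refl ![1, 0])
      simpa only [zero_add, h11, add_zero] using this
    have abb : r ![1, 0] ![0, 1] → r ![0, 1] ![1, 1] := fun h => by
      have := hra _ _ _ _ _ _ _ _ h (hr.refl ![0, 1])
      simp only [zero_add, h11, add_zero] at this
      exact hr.symm this
    have zat : r ![0, 0] ![1, 0] → r ![1, 0] ![1, 1] → r ![0, 0] ![1, 1] := hr.trans
    have zbt : r ![0, 0] ![0, 1] → r ![0, 1] ![1, 1] → r ![0, 0] ![1, 1] := hr.trans
    have s0 : (Pi.single 0 1 : Fin 2 → D) = ![1, 0] := by ext i; fin_cases i <;> simp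
    have s1 : (Pi.single 1 1 : Fin 2 → D) = ![0, 1] := by ext i; fin_cases i <;> simp
    -- reduction to the explicit choice of the two rows
    have fin : ∀ a b c d : D, r ![a, b] ![1, 0] → r ![c, d] ![0, 1] →
        (r ![0, 0] ![1, 0] → a = 0 ∧ b = 0) → (r ![0, 0] ![0, 1] → c = 0 ∧ d = 0) →
        (r ![1, 0] ![1, 1] → a = a + c ∧ b = b + d) →
        (r ![0, 1] ![1, 1] → c = a + c ∧ d = b + d) →
        ∃ e : Matrix (Fin 2) (Fin 2) D, (∀ j, r (e j) (Pi.single j 1)) ∧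
        ∀ u v, r u v → Matrix.vecMul u e = Matrix.vecMul v e := by
      intro a b c d h1 h2 h3 h4 h5 h6
      have v0 : Matrix.vecMul ![0, 0] !![a, b; c, d] = ![0, 0] := by
        ext i; fin_cases i <;> simp
      have va : Matrix.vecMul ![1, 0] !![a, b; c, d] = ![a, b] := by
        ext i; fin_cases i <;> simp
      have vb : Matrix.vecMul ![0, 1] !![a, b; c, d] = ![c, d] := by
        ext i; fin_cases i <;> simp
      have vt : Matrix.vecMul ![1, 1] !![a, b; c, d] = ![a + c, b + d] := by
        ext i; fin_cases i <;> simp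
      have g3 : r ![0, 0] ![1, 0] → ![0, 0] = ![a, b] := fun h => by
        rw [(h3 h).1, (h3 h).2]
      have g4 : r ![0, 0] ![0, 1] → ![0, 0] = ![c, d] := fun h => by
        rw [(h4 h).1, (h4 h).2]
      have g5 : r ![1, 0] ![1, 1] → ![a, b] = ![a + c, b + d] := fun h => by
        rw [← (h5 h).1, ← (h5 h).2]
      have g6 : r ![0, 1] ![1, 1] → ![c, d] = ![a + c, b + d] := fun h => by
        rw [← (h6 h).1, ← (h6 h).2]
      refine ⟨!![a, b; c, d], ?_, ?_⟩
      · intro j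
        fin_cases j
        · change r ![a, b] (Pi.single 0 1); rw [s0]; exact h1
        · change r ![c, d] (Pi.single 1 1); rw [s1]; exact h2
      · intro u v huv
        have hvu := hr.symm huv
        rcases hu u with rfl | rfl | rfl | rfl <;> rcases hu v with rfl | rfl | rfl | rfl <;>
          simp only [v0, va, vb, vt] <;> clear hu hD hadd hra <;> grind
    by_cases p1 : r ![0, 0] ![1, 0] <;> by_cases p2 : r ![0, 0] ![0, 1]
    · exact fin 0 0 0 0 p1 p2 (by simp) (by simp) (by simp) (by simp)
    · have p3 : ¬ r ![1, 0] ![1, 1] := fun h => p2 (ztb (zat p1 h))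
      exact fin 0 0 0 1 p1 (hr.refl _) (by simp) (fun h => absurd h p2)
        (fun h => absurd h p3) (by simp)
    · have p3 : ¬ r ![0, 1] ![1, 1] := fun h => p1 (zta (zbt p2 h))
      exact fin 1 0 0 0 (hr.refl _) p2 (fun h => absurd h p1) (by simp) (by simp)
        (fun h => absurd h p3)
    · by_cases p3 : r ![1, 0] ![1, 1] <;> by_cases p4 : r ![0, 1] ![1, 1]
      · exact fin 1 1 1 1 (hr.symm p3) (hr.symm p4) (fun h => absurd h p1)
          (fun h => absurd h p2) (by simp [h11]) (by simp [h11])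
      · exact fin 1 1 0 1 (hr.symm p3) (hr.refl _) (fun h => absurd h p1)
          (fun h => absurd h p2) (by simp [h11]) (fun h => absurd h p4)
      · exact fin 1 0 1 1 (hr.refl _) (hr.symm p4) (fun h => absurd h p1)
          (fun h => absurd h p2) (fun h => absurd h p3) (by simp [h11])
      · exact fin 1 0 0 1 (hr.refl _) (hr.refl _) (fun h => absurd h p1)
          (fun h => absurd h p2) (fun h => absurd h p3) (fun h => absurd h p4)

theorem zerosumfree (D : Type u) [DivisionSemiring D] (h : ¬ ∀ d : D, ∃ d' : D, d + d' = 0)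
    (a b : D) : a + b = 0 ↔ a = 0 ∧ b = 0 := by
  have key : ∀ a b : D, a + b = 0 → a = 0 := by
    intro a b hab
    by_contra ha
    apply h
    intro d
    refine ⟨d * (a⁻¹ * b), ?_⟩
    calc d + d * (a⁻¹ * b) = d * (a⁻¹ * (a + b)) := by
          rw [mul_add, mul_add, inv_mul_cancel₀ ha, mul_one]
      _ = 0 := by rw [hab]; simp
  constructor
  · intro hab
    exact ⟨key a b hab, key b a (by rwa [add_comm])⟩
  · rintro ⟨rfl, rfl⟩; simp

theorem zerosumfree_sum {D : Type u} [AddCommMonoid D] (h : ∀ a b : D, a + b = 0 ↔ a = 0 ∧ b = 0)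
    {ι : Type*} (s : Finset ι) (f : ι → D) : ∑ i ∈ s, f i = 0 ↔ ∀ i ∈ s, f i = 0 := by
  classical
  induction s using Finset.induction_on with
  | empty => simp
  | insert a s ha ih => rw [Finset.sum_insert ha, h, ih]; simp

/-- projection of the congruence property to a factor. -/
theorem congProp_factor {ι : Type} [DecidableEq ι] (S : ι → Type u) [∀ i, Semiring (S i)]
    (h : CongProp (∀ i, S i)) (i : ι) : CongProp (S i) := by
  intro r hr hadd hmul
  obtain ⟨e, he, hxy⟩ := h (fun x y => r (x i) (y i))
    ⟨fun _ => hr.refl _, fun h => hr.symm h, fun h1 h2 => hr.trans h1 h2⟩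
    (fun a b c d h1 h2 => hadd _ _ _ _ h1 h2) (fun s a b h1 => hmul _ _ _ h1)
  refine ⟨e i, he, fun x y h1 => ?_⟩
  have := congrFun (hxy (Pi.single i x) (Pi.single i y) (by simpa using h1)) i
  simpa using this

theorem boolean_of_congProp (D : Type u) [DivisionSemiring D] (n : ℕ) (hn : 1 ≤ n)
    (hD : ¬ ∀ d : D, ∃ d' : D, d + d' = 0) (h : CongProp (Matrix (Fin n) (Fin n) D)) :
    IsBooleanSemifield D := by
  have hz := zerosumfree D hD
  obtain ⟨e, he, hxy⟩ := h (fun A B => ∀ j k, A j k = 0 ↔ B j k = 0)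
    ⟨fun _ _ _ => Iff.rfl, fun h j k => (h j k).symm, fun h1 h2 j k => (h1 j k).trans (h2 j k)⟩
    (fun a b c d h1 h2 j k => by
      simp only [Matrix.add_apply, hz, h1 j k, h2 j k])
    (fun s a b h1 j k => by
      simp only [Matrix.mul_apply, zerosumfree_sum hz, mul_eq_zero, h1])
  have h0 : e ⟨0, hn⟩ ⟨0, hn⟩ ≠ 0 := by
    rw [Ne, he]; simp
  have key : ∀ x : D, x ≠ 0 → x = 1 := by
    intro x hx
    have h1 := hxy (Matrix.diagonal fun _ => x) 1 (fun j k => by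
      by_cases hjk : j = k
      · subst hjk; simp [hx]
      · simp [hjk])
    have h2 := congrFun (congrFun h1 ⟨0, hn⟩) ⟨0, hn⟩
    rw [Matrix.diagonal_mul, one_mul] at h2
    exact mul_right_cancel₀ h0 (h2.trans (one_mul _).symm)
  refine ⟨fun x => ?_, zero_ne_one, key _ fun h => ?_⟩
  · by_cases hx : x = 0
    · exact Or.inl hx
    · exact Or.inr (key x hx)
  · exact one_ne_zero ((hz 1 1).1 h).1

theorem le_two_of_congProp (D : Type u) [DivisionSemiring D] (n : ℕ)
    (hB : IsBooleanSemifield D)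
    (hD : ¬ ∀ d : D, ∃ d' : D, d + d' = 0) (h : CongProp (Matrix (Fin n) (Fin n) D)) :
    n ≤ 2 := by
  by_contra hn
  obtain ⟨m, rfl⟩ : ∃ m, n = m + 3 := ⟨n - 3, by omega⟩
  have hz := zerosumfree D hD
  obtain ⟨-, -, h11⟩ := hB
  let P : Matrix (Fin (m + 3)) (Fin (m + 3)) D :=
    fun j k => if j ≠ k ∧ (j : ℕ) < 3 ∧ (k : ℕ) < 3 then 1 else 0
  obtain ⟨e, he, hxy⟩ := h (fun A B => A * P = B * P)
    ⟨fun _ => rfl, fun h => h.symm, fun h1 h2 => h1.trans h2⟩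
    (fun a b c d h1 h2 => by simp only [add_mul, h1, h2])
    (fun s a b h1 => by simp only [mul_assoc, h1])
  simp only [one_mul] at he
  -- off-diagonal entries vanish
  have off : ∀ j k : Fin (m + 3), j ≠ k → (j : ℕ) < 3 → (k : ℕ) < 3 → e j k = 0 := by
    intro j k hjk hj hk
    have h1 := congrFun (congrFun he j) j
    rw [Matrix.mul_apply] at h1
    have h2 : P j j = 0 := by simp [P]
    rw [h2, zerosumfree_sum hz] at h1
    have h3 := h1 k (Finset.mem_univ _)
    have h4 : P k j = 1 := by simp [P, hjk.symm, hj, hk]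
    rwa [h4, mul_one] at h3
  have d1 : ∀ j : Fin (m + 3), (j : ℕ) < 3 → e j j ≠ 0 := by
    intro j hj h0
    obtain ⟨k, hk, hjk⟩ : ∃ k : Fin (m + 3), (k : ℕ) < 3 ∧ j ≠ k := by
      by_cases h : j = ⟨0, by omega⟩
      · exact ⟨⟨1, by omega⟩, by simp, by rw [h]; simp⟩
      · exact ⟨⟨0, by omega⟩, by simp, h⟩
    have h1 := congrFun (congrFun he j) k
    rw [Matrix.mul_apply] at h1
    have h2 : P j k = 1 := by simp [P, hjk, hj, hk]
    have h3 : ∑ l, e j l * P l k = 0 := by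
      apply Finset.sum_eq_zero
      intro l _
      by_cases hl : (l : ℕ) < 3
      · by_cases hjl : j = l
        · subst hjl; rw [h0, zero_mul]
        · rw [off j l hjl hj hl, zero_mul]
      · simp [P, hl]
    rw [h3, h2] at h1
    exact zero_ne_one h1
  let i0 : Fin (m + 3) := ⟨0, by omega⟩
  let i1 : Fin (m + 3) := ⟨1, by omega⟩
  let i2 : Fin (m + 3) := ⟨2, by omega⟩
  have hrow : ∀ (i j : Fin (m + 3)) (A : Matrix (Fin (m + 3)) (Fin (m + 3)) D) (k : Fin (m + 3)),
      ((Matrix.single i0 i 1 + Matrix.single i0 j 1 :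
        Matrix (Fin (m + 3)) (Fin (m + 3)) D) * A) i0 k = A i k + A j k := by
    intro i j A k
    simp [add_mul]
  have h1 := hxy (Matrix.single i0 i0 1 + Matrix.single i0 i1 1)
    (Matrix.single i0 i0 1 + Matrix.single i0 i2 1) (by
      ext a k
      by_cases ha : a = i0
      · subst ha
        rw [hrow, hrow]
        by_cases hk : (k : ℕ) < 3
        · have : k = i0 ∨ k = i1 ∨ k = i2 := by
            simp only [i0, i1, i2, Fin.ext_iff]; omega
          rcases this with rfl | rfl | rfl <;> simp [P, i0, i1, i2, h11]
        · simp [P, hk]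
      · simp [add_mul, ha])
  have h2 := congrFun (congrFun h1 i0) i1
  rw [hrow, hrow, off i0 i1 (by simp [i0, i1]) (by simp [i0]) (by simp [i1]),
    off i2 i1 (by simp [i2, i1]) (by simp [i2]) (by simp [i1])] at h2
  simp only [zero_add] at h2
  exact d1 i1 (by simp [i1]) h2

/-- a semisimple semiring `S = Π i, M_{n i}(D i)` is a left
CP-semiring iff for every `i`, either `D i` is a division ring, or `D i ≅ B`
and `n i = 1` or `n i = 2`. -/
theorem semisimple_isLeftCPSemiring_iff
    (r : ℕ) (D : Fin r → Type u) [∀ i, DivisionSemiring (D i)]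
    (n : Fin r → ℕ) (hn : ∀ i, 1 ≤ n i) :
    IsLeftCPSemiring (∀ i : Fin r, Matrix (Fin (n i)) (Fin (n i)) (D i)) ↔
      ∀ i : Fin r,
        (∀ d : D i, ∃ d' : D i, d + d' = 0) ∨
        (IsBooleanSemifield (D i) ∧ (n i = 1 ∨ n i = 2)) := by
  constructor
  · intro h i
    have h1 := congProp_factor _ (congProp_of_cp _ h) i
    by_cases hD : ∀ d : D i, ∃ d' : D i, d + d' = 0
    · exact Or.inl hD
    · have hB := boolean_of_congProp (D i) (n i) (hn i) hD h1
      have h2 := le_two_of_congProp (D i) (n i) hB hD h1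
      have := hn i
      exact Or.inr ⟨hB, by omega⟩
  · intro h
    apply cp_of_congProp
    apply congProp_pi
    intro i
    rcases h i with h | ⟨hB, h2⟩
    · exact congProp_matrix_ring (D i) (n i) h
    · exact congProp_bool (D i) (n i) hB h2
end
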